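/- arXiv:solv-int/9808008 — 2 statements merged into one kernel-verified Lean document; each statement's English description precedes it below -/
import Mathlib

section
/- Let n be a positive integer, U ⊆ ℝⁿ an open set with coordinates u₁,…,uₙ, τ : U → ℂ a smooth nowhere-vanishing function, and γ_{ij} : U → ℂ (i ≠ j) smooth functions. Define γ_{ii} := −(∂τ/∂u_i)/τ. Assume: (a) ∂γ_{ii}/∂u_j = γ_{ij}·γ_{ji} for all j ≠ i; (b) Σ_{j=1}^{n} ∂γ_{ii}/∂u_j = 0 for all i; (c) τ is homogeneous of some degree N ∈ ℂ, i.e. Σ_{j=1}^{n} u_j ∂τ/∂u_j = N·τ on U. Then for every i = 1,…,n the quadratic Hamiltonian H_i := (1/2)·Σ_{j≠i} γ_{ij}·γ_{ji}·(u_i − u_j) satisfies H_i = −(1/2)·(∂τ/∂u_i)/τ on U. (Consequently the isomonodromy tau-function τ_I, defined by d log τ_I = Σ_i H_i du_i, satisfies d log τ_I = −(1/2) d log τ.) -/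
open Matrix Finset

/-- Partial derivative `∂f/∂u_k` of a function on `ℝⁿ`. -/
noncomputable def pd {n : ℕ} {E : Type*} [NormedAddCommGroup E] [NormedSpace ℝ E]
    (k : Fin n) (f : (Fin n → ℝ) → E) (u : Fin n → ℝ) : E :=
  fderiv ℝ f u (Pi.single k 1)

theorem ContDiffOn.differentiableAt_pd {n : ℕ} {E : Type*} [NormedAddCommGroup E]
    [NormedSpace ℝ E] {f : (Fin n → ℝ) → E} {U : Set (Fin n → ℝ)}
    (hf : ContDiffOn ℝ 2 f U) (hU : IsOpen U) (k : Fin n) {u : Fin n → ℝ} (hu : u ∈ U) :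
    DifferentiableAt ℝ (pd k f) u := by
  have h : ContDiffOn ℝ 1 (fderiv ℝ f) U := hf.fderiv_of_isOpen hU (by norm_num)
  have h' : DifferentiableAt ℝ (fderiv ℝ f) u :=
    (h.contDiffAt (hU.mem_nhds hu)).differentiableAt (by norm_num)
  exact h'.clm_apply (differentiableAt_const _)

/-- Product rule for the Euler-type sum `∑ j, u_j g_j`. -/
theorem pd_sum_coord_mul {n : ℕ} {g : Fin n → (Fin n → ℝ) → ℂ} {u : Fin n → ℝ}
    (hg : ∀ j, DifferentiableAt ℝ (g j) u) (i : Fin n) :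
    pd i (fun v => ∑ j, (v j : ℂ) * g j v) u = g i u + ∑ j, (u j : ℂ) * pd i (g j) u := by
  have hc (j : Fin n) : HasFDerivAt (fun v : Fin n → ℝ => (v j : ℂ))
      (Complex.ofRealCLM.comp (ContinuousLinearMap.proj j : (Fin n → ℝ) →L[ℝ] ℝ)) u :=
    (Complex.ofRealCLM.comp (ContinuousLinearMap.proj j : (Fin n → ℝ) →L[ℝ] ℝ)).hasFDerivAt
  have h := HasFDerivAt.fun_sum (u := Finset.univ)
    fun j _ => (hc j).fun_mul (hg j).hasFDerivAt
  rw [pd, h.fderiv]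
  simp [pd, Finset.sum_add_distrib, Pi.single_apply, apply_ite, add_comm]

/-- For a homogeneous tau-function `τ` with rotation coefficients `γ_{ij}` whose diagonal
is `γ_{ii} = −(∂τ/∂u_i)/τ`, the quadratic Hamiltonians
`H_i = (1/2)Σ_{j≠i} γ_{ij}γ_{ji}(u_i − u_j)` satisfy `H_i = −(1/2)(∂τ/∂u_i)/τ`,
i.e. `d log τ_I = −(1/2) d log τ`. -/
theorem isomonodromy_tau_equals_KP_tau
    (n : ℕ) (hn : 0 < n) (U : Set (Fin n → ℝ)) (hU : IsOpen U)
    (τ : (Fin n → ℝ) → ℂ) (hτsm : ContDiffOn ℝ (⊤ : ℕ∞) τ U) (hτ0 : ∀ u ∈ U, τ u ≠ 0)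
    (γ : Fin n → Fin n → (Fin n → ℝ) → ℂ)
    (hγsm : ∀ i j, i ≠ j → ContDiffOn ℝ (⊤ : ℕ∞) (γ i j) U)
    -- the diagonal rotation coefficient `γ_{ii} := −(∂τ/∂u_i)/τ`
    (ha : ∀ i j, j ≠ i → ∀ u ∈ U,
      pd j (fun v => -(pd i τ v) / τ v) u = γ i j u * γ j i u)
    (hb : ∀ i, ∀ u ∈ U, ∑ j, pd j (fun v => -(pd i τ v) / τ v) u = 0)
    (N : ℂ)
    (hhom : ∀ u ∈ U, ∑ j, (u j : ℂ) * pd j τ u = N * τ u) :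
    ∀ i, ∀ u ∈ U,
      (1/2 : ℂ) * ∑ j ∈ Finset.univ.erase i, γ i j u * γ j i u * ((u i : ℂ) - (u j : ℂ))
        = -(1/2 : ℂ) * (pd i τ u) / τ u := by
  intro i u hu
  set g : Fin n → (Fin n → ℝ) → ℂ := fun i v => -(pd i τ v) / τ v with hg
  have hτ2 : ContDiffOn ℝ 2 τ U := hτsm.of_le (WithTop.coe_le_coe.2 (le_top : (2 : ℕ∞) ≤ ⊤))
  have hτd : DifferentiableAt ℝ τ u :=
    (hτ2.contDiffAt (hU.mem_nhds hu)).differentiableAt (by norm_num)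
  have hgd (j : Fin n) : DifferentiableAt ℝ (g j) u := by
    simp only [hg, div_eq_mul_inv]
    exact (hτ2.differentiableAt_pd hU j hu).fun_neg.fun_mul (hτd.fun_inv (hτ0 u hu))
  have hsymm (j : Fin n) : pd i (g j) u = pd j (g i) u := by
    rcases eq_or_ne j i with rfl | hji
    · rfl
    · rw [ha i j hji u hu, ha j i hji.symm u hu, mul_comm]
  have hconst : (fun v : Fin n → ℝ => ∑ j, (v j : ℂ) * g j v) =ᶠ[nhds u] fun _ => -N := by
    filter_upwards [hU.mem_nhds hu] with v hv
    have hv0 := hτ0 v hv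
    calc ∑ j, (v j : ℂ) * g j v = -(∑ j, (v j : ℂ) * pd j τ v) / τ v := by
          rw [← Finset.sum_neg_distrib, Finset.sum_div]
          exact Finset.sum_congr rfl fun j _ => by simp only [hg]; ring
      _ = -N := by rw [hhom v hv]; field_simp
  have heuler : g i u + ∑ j, (u j : ℂ) * pd j (g i) u = 0 := by
    simp only [← hsymm]
    rw [← pd_sum_coord_mul hgd i, pd, hconst.fderiv_eq]
    simp
  have hsum : ∑ j ∈ Finset.univ.erase i, γ i j u * γ j i u * ((u i : ℂ) - (u j : ℂ)) = g i u := by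
    calc _ = ∑ j ∈ Finset.univ.erase i, pd j (g i) u * ((u i : ℂ) - (u j : ℂ)) :=
          Finset.sum_congr rfl fun j hj => by rw [← ha i j (Finset.ne_of_mem_erase hj) u hu]
      _ = ∑ j, pd j (g i) u * ((u i : ℂ) - (u j : ℂ)) :=
          Finset.sum_erase _ (by simp)
      _ = (∑ j, pd j (g i) u) * u i - ∑ j, (u j : ℂ) * pd j (g i) u := by
          rw [Finset.sum_mul, ← Finset.sum_sub_distrib]
          exact Finset.sum_congr rfl fun j _ => by ring
      _ = g i u := by
          rw [hb i u hu]
          linear_combination -heuler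
  rw [hsum]
  simp only [hg]
  ring
end

section
/- Let n ≥ 2 and let a = (a₁,…,aₙ) ∈ ℂⁿ be an isotropic vector, i.e. Σ_{k=1}^{n} a_k² = 0. On the open set U = {u ∈ ℝⁿ : τ₀(u) ≠ 0}, where τ₀(u) = Σ_{k=1}^{n} a_k² u_k, define γ_{ij}(u) = −a_i a_j / τ₀(u) for all 1 ≤ i,j ≤ n. Then: (a) γ_{ij} = γ_{ji}; (b) ∂γ_{ij}/∂u_k = γ_{ik}·γ_{kj} for ALL indices i,j,k (in particular for k ∉ {i,j}); (c) Σ_{k=1}^{n} ∂γ_{ij}/∂u_k = 0; (d) Σ_{k=1}^{n} u_k ∂γ_{ij}/∂u_k = −γ_{ij}. Hence the γ_{ij} are rotation coefficients solving the Darboux–Egoroff system together with the degree −1 homogeneity condition, and γ_{ii} = −(∂τ₀/∂u_i)/τ₀. -/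
open Matrix Finset

/-- `τ₀(u) = Σ_k a_k² u_k`. -/
noncomputable def tau0 {n : ℕ} (a : Fin n → ℂ) (u : Fin n → ℝ) : ℂ :=
  ∑ k, (a k) ^ 2 * (u k : ℂ)

/-- The rotation coefficients `γ_{ij} = −a_i a_j / τ₀`. -/
noncomputable def gam {n : ℕ} (a : Fin n → ℂ) (i j : Fin n) (u : Fin n → ℝ) : ℂ :=
  -(a i * a j) / tau0 a u

theorem hasFDerivAt_tau0 {n : ℕ} (a : Fin n → ℂ) (u : Fin n → ℝ) :
    HasFDerivAt (tau0 a)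
      (∑ k, (a k) ^ 2 • Complex.ofRealCLM.comp (ContinuousLinearMap.proj (R := ℝ) k)) u := by
  unfold tau0
  refine HasFDerivAt.fun_sum fun k _ => ?_
  exact (Complex.ofRealCLM.comp
    (ContinuousLinearMap.proj (R := ℝ) (φ := fun _ : Fin n => ℝ) k)).hasFDerivAt.const_mul _

theorem pd_tau0 {n : ℕ} (a : Fin n → ℂ) (u : Fin n → ℝ) (k : Fin n) :
    pd k (tau0 a) u = (a k) ^ 2 := by
  simp [pd, (hasFDerivAt_tau0 a u).fderiv, Pi.single_apply, apply_ite Complex.ofReal]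

theorem pd_gam {n : ℕ} (a : Fin n → ℂ) {u : Fin n → ℝ} (hu : tau0 a u ≠ 0) (i j k : Fin n) :
    pd k (gam a i j) u = a i * a j / tau0 a u ^ 2 * (a k) ^ 2 := by
  have hd : HasFDerivAt (gam a i j) _ u :=
    ((hasDerivAt_inv hu).comp_hasFDerivAt u (hasFDerivAt_tau0 a u)).const_mul (-(a i * a j))
  have hk := pd_tau0 a u k
  rw [pd, (hasFDerivAt_tau0 a u).fderiv] at hk
  rw [pd, hd.fderiv, _root_.smul_apply, _root_.smul_apply, hk]
  simp only [smul_eq_mul]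
  ring

/-- For an isotropic vector `a ∈ ℂⁿ`, the functions `γ_{ij} = −a_i a_j/τ₀` solve the
Darboux–Egoroff system on `{τ₀ ≠ 0}`, together with the degree `−1` homogeneity condition,
and `γ_{ii} = −(∂τ₀/∂u_i)/τ₀`. -/
theorem example_rotation_coefficients
    (n : ℕ) (hn : 2 ≤ n) (a : Fin n → ℂ) (hiso : ∑ k, (a k) ^ 2 = 0) :
    ∀ u : Fin n → ℝ, tau0 a u ≠ 0 →
      (∀ i j, gam a i j u = gam a j i u) ∧
      (∀ i j k, pd k (gam a i j) u = gam a i k u * gam a k j u) ∧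
      (∀ i j, ∑ k, pd k (gam a i j) u = 0) ∧
      (∀ i j, ∑ k, (u k : ℂ) * pd k (gam a i j) u = -gam a i j u) ∧
      (∀ i, gam a i i u = -(pd i (tau0 a) u) / tau0 a u) := by
  intro u hu
  refine ⟨fun i j => ?_, fun i j k => ?_, fun i j => ?_, fun i j => ?_, fun i => ?_⟩
  · rw [gam, gam, mul_comm (a i)]
  · rw [pd_gam a hu, gam, gam]
    ring
  · simp_rw [pd_gam a hu]
    rw [← mul_sum, hiso, mul_zero]
  · have hsum : ∑ k, (u k : ℂ) * pd k (gam a i j) u =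
        a i * a j / tau0 a u ^ 2 * tau0 a u := by
      simp_rw [pd_gam a hu]
      conv_rhs => rw [tau0, mul_sum]
      refine sum_congr rfl fun k _ => ?_
      rw [tau0]
      ring
    rw [hsum, gam]
    field_simp
  · rw [pd_tau0, gam, sq]
end
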